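/- Let G₄ be the 6×6 matrix (1/2)·[2,1,1,0,1,1; 1,2,1,1,0,1; 1,1,2,1,1,2; 0,1,1,2,1,1; 1,0,1,1,2,1; 1,1,2,1,1,2]. For nonzero z: ∑_{N₁,...,N₆≥0} z^{N₁+N₃+N₄+N₆} q^{NᵀG₄N - (N₁+N₂+N₆)} / ∏_i (q²;q²)_{N_i} = 2(-z;q)_∞ / (q;q²)_∞. -/

import Mathlib

open scoped BigOperators

/-- Finite q-Pochhammer symbol $(a;q)_n$. -/
noncomputable def qPoch (q a : ℂ) (n : ℕ) : ℂ := ∏ j ∈ Finset.range n, (1 - a * q ^ j)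

/-- Infinite q-Pochhammer symbol $(a;q)_\infty$. -/
noncomputable def qPochInf (q a : ℂ) : ℂ := ∏' j : ℕ, (1 - a * q ^ j)

/-- The quadratic form $N^T G_4 N$ for the $6\times 6$ matrix
$G_4=\frac12\begin{pmatrix}2&1&1&0&1&1\\1&2&1&1&0&1\\1&1&2&1&1&2\\0&1&1&2&1&1\\1&0&1&1&2&1\\1&1&2&1&1&2\end{pmatrix}$. -/
def Q4 (n₁ n₂ n₃ n₄ n₅ n₆ : ℕ) : ℕ :=
  n₁ ^ 2 + n₂ ^ 2 + n₃ ^ 2 + n₄ ^ 2 + n₅ ^ 2 + n₆ ^ 2 +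
    n₁ * n₂ + n₁ * n₃ + n₁ * n₅ + n₁ * n₆ +
    n₂ * n₃ + n₂ * n₄ + n₂ * n₆ +
    n₃ * n₄ + n₃ * n₅ + 2 * (n₃ * n₆) +
    n₄ * n₅ + n₄ * n₆ + n₅ * n₆

open Filter Topology
open Finset.HasAntidiagonal (antidiagonal mem_antidiagonal)

/-- Coefficients of the power series solution, with constant term `1`, of the `q`-difference
equation $(1+\alpha X)F(X)=(1+\beta X)F(qX)$. -/
noncomputable def qDiffCoeff (q α β : ℂ) (n : ℕ) : ℂ :=
  ∏ k ∈ Finset.range n, (β * q ^ k - α) / (1 - q ^ (k + 1))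

lemma one_sub_pow_succ_ne_zero {q : ℂ} (hq : ‖q‖ < 1) (k : ℕ) : 1 - q ^ (k + 1) ≠ 0 := by
  intro h
  have h1 : ‖q ^ (k + 1)‖ < 1 := by
    rw [norm_pow]
    exact pow_lt_one₀ (norm_nonneg _) hq k.succ_ne_zero
  rw [← sub_eq_zero.1 h] at h1
  simp at h1

lemma qDiffCoeff_zero (q α β : ℂ) : qDiffCoeff q α β 0 = 1 := by simp [qDiffCoeff]

lemma qDiffCoeff_succ {q : ℂ} (hq : ‖q‖ < 1) (α β : ℂ) (n : ℕ) :
    qDiffCoeff q α β (n + 1) * (1 - q ^ (n + 1)) = (β * q ^ n - α) * qDiffCoeff q α β n := by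
  have := one_sub_pow_succ_ne_zero hq n
  rw [qDiffCoeff, Finset.prod_range_succ, ← qDiffCoeff]
  field_simp

lemma qDiffCoeff_eq_div (q α β : ℂ) (n : ℕ) :
    qDiffCoeff q α β n = (∏ k ∈ Finset.range n, (β * q ^ k - α)) / qPoch q q n := by
  rw [qDiffCoeff, Finset.prod_div_distrib, qPoch]
  simp only [pow_succ']

lemma coeff_succ_one_add_C_mul_X_mul (a : ℂ) (F : PowerSeries ℂ) (n : ℕ) :
    PowerSeries.coeff (n + 1) ((1 + PowerSeries.C a * PowerSeries.X) * F) =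
      PowerSeries.coeff (n + 1) F + a * PowerSeries.coeff n F := by
  rw [add_mul, one_mul, mul_assoc, map_add, PowerSeries.coeff_C_mul,
    PowerSeries.coeff_succ_X_mul]

lemma qDiffCoeff_equation {q : ℂ} (hq : ‖q‖ < 1) (α β : ℂ) :
    (1 + PowerSeries.C α * PowerSeries.X) * PowerSeries.mk (qDiffCoeff q α β) =
      (1 + PowerSeries.C β * PowerSeries.X) *
        PowerSeries.rescale q (PowerSeries.mk (qDiffCoeff q α β)) := by
  ext n
  cases n with
  | zero =>
    simp [PowerSeries.coeff_mul, PowerSeries.coeff_rescale]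
  | succ n =>
    simp only [coeff_succ_one_add_C_mul_X_mul, PowerSeries.coeff_rescale, PowerSeries.coeff_mk]
    linear_combination qDiffCoeff_succ hq α β n

lemma eq_mk_qDiffCoeff {q : ℂ} (hq : ‖q‖ < 1) (α β : ℂ) (F : PowerSeries ℂ)
    (h0 : PowerSeries.coeff 0 F = 1)
    (hF : (1 + PowerSeries.C α * PowerSeries.X) * F =
      (1 + PowerSeries.C β * PowerSeries.X) * PowerSeries.rescale q F) :
    F = PowerSeries.mk (qDiffCoeff q α β) := by
  ext n
  rw [PowerSeries.coeff_mk]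
  induction n with
  | zero => rw [h0, qDiffCoeff_zero]
  | succ n ih =>
    have h := congrArg (PowerSeries.coeff (n + 1)) hF
    simp only [coeff_succ_one_add_C_mul_X_mul, PowerSeries.coeff_rescale] at h
    refine mul_right_cancel₀ (one_sub_pow_succ_ne_zero hq n) ?_
    rw [qDiffCoeff_succ hq, ← ih]
    linear_combination h

lemma norm_sq_lt_one {q : ℂ} (hq : ‖q‖ < 1) : ‖q ^ 2‖ < 1 := by
  rw [norm_pow]
  exact pow_lt_one₀ (norm_nonneg _) hq two_ne_zero

/-- Dissection of a base-`q` series into two base-`q²` series: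
if $F(X)$ solves the equation in base $q^2$, then $F(X)F(qX)$ solves it in base $q$. -/
lemma sum_antidiagonal_qDiffCoeff_sq {q : ℂ} (hq : ‖q‖ < 1) (α β : ℂ) (n : ℕ) :
    ∑ x ∈ antidiagonal n,
      qDiffCoeff (q ^ 2) α β x.1 * (q ^ x.2 * qDiffCoeff (q ^ 2) α β x.2) =
      qDiffCoeff q α β n := by
  set F := PowerSeries.mk (qDiffCoeff (q ^ 2) α β) with hFdef
  have key : F * PowerSeries.rescale q F = PowerSeries.mk (qDiffCoeff q α β) := by
    apply eq_mk_qDiffCoeff hq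
    · simp [hFdef, PowerSeries.coeff_mul, qDiffCoeff_zero]
    · have h := qDiffCoeff_equation (norm_sq_lt_one hq) α β
      have h2 : PowerSeries.rescale q (PowerSeries.rescale q F) =
          PowerSeries.rescale (q ^ 2) F := by
        rw [PowerSeries.rescale_rescale, sq]
      rw [← hFdef] at h
      rw [map_mul, h2]
      linear_combination PowerSeries.rescale q F * h
  have h := congrArg (PowerSeries.coeff n) key
  simpa [PowerSeries.coeff_mul, hFdef, PowerSeries.coeff_rescale] using h

lemma sum_antidiagonal_qDiffCoeff_mul {q : ℂ} (hq : ‖q‖ < 1) (α β : ℂ) (n : ℕ) :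
    ∑ x ∈ antidiagonal n, qDiffCoeff q α 0 x.1 * qDiffCoeff q 0 β x.2 =
      qDiffCoeff q α β n := by
  have key : PowerSeries.mk (qDiffCoeff q α 0) * PowerSeries.mk (qDiffCoeff q 0 β) =
      PowerSeries.mk (qDiffCoeff q α β) := by
    apply eq_mk_qDiffCoeff hq
    · simp [PowerSeries.coeff_mul, qDiffCoeff_zero]
    · have h := qDiffCoeff_equation hq α 0
      have h' := qDiffCoeff_equation hq 0 β
      simp only [map_zero, zero_mul, add_zero, one_mul] at h h'
      rw [map_mul]
      linear_combination PowerSeries.mk (qDiffCoeff q 0 β) * h +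
        PowerSeries.rescale q (PowerSeries.mk (qDiffCoeff q α 0)) * h'
  have h := congrArg (PowerSeries.coeff n) key
  simpa [PowerSeries.coeff_mul] using h

/-- Summing over antidiagonals a family whose factor `R` depends only on the sum of the first
two indices. -/
lemma HasSum.mul_antidiagonal {γ : Type*} {a : ℕ × ℕ → ℂ} {c : ℕ → ℂ} {R : ℕ → γ → ℂ} {s : ℂ}
    (hc : ∀ n, ∑ x ∈ antidiagonal n, a x = c n)
    (hf : HasSum (fun p : (ℕ × ℕ) × γ => a p.1 * R (p.1.1 + p.1.2) p.2) s) :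
    HasSum (fun p : ℕ × γ => c p.1 * R p.1 p.2) s := by
  classical
  refine (hf.tsum_fiberwise fun p : (ℕ × ℕ) × γ => (p.1.1 + p.1.2, p.2)).congr_fun
    fun p => ?_
  obtain ⟨n, d⟩ := p
  have hset : (fun p : (ℕ × ℕ) × γ => (p.1.1 + p.1.2, p.2)) ⁻¹' {(n, d)} =
      ((antidiagonal n ×ˢ {d} : Finset ((ℕ × ℕ) × γ)) :
        Set ((ℕ × ℕ) × γ)) := by
    ext ⟨x, e⟩
    rw [Finset.mem_coe, Finset.mem_product, mem_antidiagonal]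
    simp
  rw [hset, Finset.tsum_subtype' _ fun p : (ℕ × ℕ) × γ => a p.1 * R (p.1.1 + p.1.2) p.2,
    Finset.sum_product, ← hc, Finset.sum_mul]
  refine Finset.sum_congr rfl fun x hx => ?_
  rw [Finset.sum_singleton, mem_antidiagonal.1 hx]

lemma HasSum.rotate {α β γ : Type*} {f : α × β × γ → ℂ} {s : ℂ} (hf : HasSum f s) :
    HasSum (fun p : β × γ × α => f (p.2.2, p.1, p.2.1)) s :=
  ((Equiv.prodAssoc β γ α).symm.trans (Equiv.prodComm (β × γ) α)).hasSum_iff.2 hf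

lemma summable_mul_pow {q : ℂ} (hq : ‖q‖ < 1) (a : ℂ) : Summable fun j : ℕ => ‖-(a * q ^ j)‖ := by
  simp only [norm_neg, norm_mul, norm_pow]
  exact (summable_geometric_of_lt_one (norm_nonneg _) hq).mul_left _

lemma tendsto_qPoch {q : ℂ} (hq : ‖q‖ < 1) (a : ℂ) :
    Tendsto (qPoch q a) atTop (𝓝 (qPochInf q a)) := by
  have h := (multipliable_one_add_of_summable (summable_mul_pow hq a)).hasProd.tendsto_prod_nat
  simp only [← sub_eq_add_neg] at h
  exact h

lemma qPochInf_self_ne_zero {q : ℂ} (hq : ‖q‖ < 1) : qPochInf q q ≠ 0 := by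
  have h := tprod_one_add_ne_zero_of_summable (f := fun j : ℕ => -(q * q ^ j))
    (fun j => by
      rw [← sub_eq_add_neg, ← pow_succ']
      exact one_sub_pow_succ_ne_zero hq j) (summable_mul_pow hq q)
  simp only [← sub_eq_add_neg] at h
  exact h

lemma qPoch_add (q a : ℂ) (m n : ℕ) :
    qPoch q a (m + n) = qPoch q a m * qPoch q (a * q ^ m) n := by
  simp only [qPoch, Finset.prod_range_add, pow_add, mul_assoc]

lemma qPoch_mul_qPochInf {q : ℂ} (hq : ‖q‖ < 1) (a : ℂ) (m : ℕ) :
    qPoch q a m * qPochInf q (a * q ^ m) = qPochInf q a := by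
  refine tendsto_nhds_unique ((tendsto_qPoch hq (a * q ^ m)).const_mul (qPoch q a m)) ?_
  have h := (tendsto_add_atTop_iff_nat m).2 (tendsto_qPoch hq a)
  simpa only [add_comm _ m, qPoch_add] using h

lemma qPoch_two_mul (q : ℂ) (n : ℕ) :
    qPoch q q (2 * n) = qPoch (q ^ 2) q n * qPoch (q ^ 2) (q ^ 2) n := by
  induction n with
  | zero => simp [qPoch]
  | succ n ih =>
    simp only [qPoch] at ih ⊢
    rw [show 2 * (n + 1) = 2 * n + 1 + 1 by ring]
    simp only [Finset.prod_range_succ, ih]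
    ring

lemma qPoch_sq_sq (q : ℂ) (n : ℕ) :
    qPoch (q ^ 2) (q ^ 2) n = qPoch q q n * qPoch q (-q) n := by
  simp only [qPoch, ← Finset.prod_mul_distrib]
  exact Finset.prod_congr rfl fun j _ => by ring

/-- Euler's identity $(-q;q)_\infty (q;q^2)_\infty = 1$. -/
lemma qPochInf_neg_self_mul {q : ℂ} (hq : ‖q‖ < 1) :
    qPochInf q (-q) * qPochInf (q ^ 2) q = 1 := by
  have hq2 := norm_sq_lt_one hq
  have h2n : Tendsto (fun n : ℕ => 2 * n) atTop atTop :=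
    tendsto_id.const_mul_atTop' two_pos
  have h1 : qPochInf q q = qPochInf (q ^ 2) q * qPochInf (q ^ 2) (q ^ 2) := by
    refine tendsto_nhds_unique ((tendsto_qPoch hq q).comp h2n) ?_
    have h := (tendsto_qPoch hq2 q).mul (tendsto_qPoch hq2 (q ^ 2))
    simp only [← qPoch_two_mul] at h
    exact h
  have h2 : qPochInf (q ^ 2) (q ^ 2) = qPochInf q q * qPochInf q (-q) := by
    refine tendsto_nhds_unique (tendsto_qPoch hq2 (q ^ 2)) ?_
    have h := (tendsto_qPoch hq q).mul (tendsto_qPoch hq (-q))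
    simpa only [← qPoch_sq_sq] using h
  refine mul_left_cancel₀ (qPochInf_self_ne_zero hq) ?_
  rw [h2] at h1
  linear_combination -h1

lemma qPochInf_neg_one {q : ℂ} (hq : ‖q‖ < 1) :
    qPochInf q (-1) = 2 / qPochInf (q ^ 2) q := by
  have h := qPochInf_neg_self_mul hq
  have h1 := qPoch_mul_qPochInf hq (-1) 1
  have h0 : qPochInf (q ^ 2) q ≠ 0 := right_ne_zero_of_mul_eq_one h
  rw [eq_div_iff h0, ← h1]
  simp only [qPoch, Finset.prod_range_one, pow_zero, pow_one, neg_one_mul]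
  linear_combination 2 * h

lemma summable_pow_mul_qDiffCoeff {q : ℂ} (hq : ‖q‖ < 1) (x : ℂ) :
    Summable fun n : ℕ => x ^ n * qDiffCoeff q 0 1 n := by
  have hpow : Tendsto (fun n : ℕ => q ^ n) atTop (𝓝 0) :=
    tendsto_pow_atTop_nhds_zero_of_norm_lt_one hq
  have hlim : Tendsto (fun n : ℕ => ‖x * q ^ n / (1 - q ^ (n + 1))‖) atTop (𝓝 0) := by
    have h := ((hpow.const_mul x).div (((tendsto_add_atTop_iff_nat 1).2 hpow).const_sub 1)
      (by simp)).norm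
    simpa using h
  refine summable_of_ratio_norm_eventually_le (r := 1 / 2) (by norm_num) ?_
  filter_upwards [hlim.eventually_le_const (show (0 : ℝ) < 1 / 2 by norm_num)] with n hn
  have h : x ^ (n + 1) * qDiffCoeff q 0 1 (n + 1) =
      x * q ^ n / (1 - q ^ (n + 1)) * (x ^ n * qDiffCoeff q 0 1 n) := by
    rw [qDiffCoeff, Finset.prod_range_succ, ← qDiffCoeff]
    ring
  rw [h, norm_mul]
  gcongr

/-- Euler's expansion $\sum_n x^n q^{n(n-1)/2}/(q;q)_n = (-x;q)_\infty$. -/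
lemma hasSum_pow_mul_qDiffCoeff {q : ℂ} (hq : ‖q‖ < 1) (x : ℂ) :
    HasSum (fun n : ℕ => x ^ n * qDiffCoeff q 0 1 n) (qPochInf q (-x)) := by
  set F : ℂ → ℂ := fun y => ∑' n : ℕ, y ^ n * qDiffCoeff q 0 1 n with hF
  have hsum := summable_pow_mul_qDiffCoeff hq
  have hrec : ∀ y, F y = (1 + y) * F (y * q) := by
    intro y
    have h1 : F y - F (y * q) = ∑' n : ℕ, (y ^ n - (y * q) ^ n) * qDiffCoeff q 0 1 n := by
      rw [hF, ← (hsum y).tsum_sub (hsum (y * q))]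
      exact tsum_congr fun n => by ring
    have hs : Summable fun n : ℕ => (y ^ n - (y * q) ^ n) * qDiffCoeff q 0 1 n :=
      ((hsum y).sub (hsum (y * q))).congr fun n => by ring
    have h2 : ∑' n : ℕ, (y ^ n - (y * q) ^ n) * qDiffCoeff q 0 1 n = y * F (y * q) := by
      rw [hs.tsum_eq_zero_add, hF, ← tsum_mul_left]
      simp only [pow_zero, sub_self, zero_mul, zero_add]
      refine tsum_congr fun n => ?_
      linear_combination y ^ (n + 1) * qDiffCoeff_succ hq 0 1 n
    linear_combination h1 + h2
  have hiter : ∀ n : ℕ, qPoch q (-x) n * F (x * q ^ n) = F x := by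
    intro n
    induction n with
    | zero => simp [qPoch]
    | succ n ih =>
      rw [← ih, hrec (x * q ^ n), qPoch, Finset.prod_range_succ, ← qPoch, pow_succ]
      ring_nf
  have hF1 : Tendsto (fun n : ℕ => F (x * q ^ n)) atTop (𝓝 1) := by
    have h : Tendsto (fun n : ℕ => F (x * q ^ n)) atTop
        (𝓝 (∑' k : ℕ, if k = 0 then (1 : ℂ) else 0)) := by
      refine tendsto_tsum_of_dominated_convergence (hsum x).norm ?_ ?_
      · intro k
        have hpow : Tendsto (fun n : ℕ => x * q ^ n) atTop (𝓝 0) := by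
          simpa using (tendsto_pow_atTop_nhds_zero_of_norm_lt_one hq).const_mul x
        have h := (hpow.pow k).mul_const (qDiffCoeff q 0 1 k)
        convert h using 2
        rcases k with _ | k <;> simp [qDiffCoeff_zero]
      · refine Eventually.of_forall fun n k => ?_
        rw [norm_mul, norm_mul, norm_pow, norm_pow, norm_mul, norm_pow]
        gcongr
        exact mul_le_of_le_one_right (norm_nonneg _) (pow_le_one₀ (norm_nonneg _) hq.le)
    simpa using h
  have hval : F x = qPochInf q (-x) := by
    refine tendsto_nhds_unique tendsto_const_nhds (f := fun _ : ℕ => F x) (l := atTop) ?_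
    simpa [hiter] using (tendsto_qPoch hq (-x)).mul hF1
  rw [← hval]
  exact (hsum x).hasSum

lemma qDiffCoeff_zero_one (q : ℂ) (n : ℕ) :
    qDiffCoeff q 0 1 n = (∏ k ∈ Finset.range n, q ^ k) / qPoch q q n := by
  simp [qDiffCoeff_eq_div]

lemma qDiffCoeff_neg_one_zero (q : ℂ) (n : ℕ) :
    qDiffCoeff q (-1) 0 n = 1 / qPoch q q n := by
  simp [qDiffCoeff_eq_div]

lemma qDiffCoeff_neg_one_one (q : ℂ) (n : ℕ) :
    qDiffCoeff q (-1) 1 n = qPoch q (-1) n / qPoch q q n := by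
  rw [qDiffCoeff_eq_div, qPoch.eq_def q (-1)]
  congr 1
  exact Finset.prod_congr rfl fun j _ => by ring

lemma prod_range_sq_pow {q : ℂ} (hq0 : q ≠ 0) (n : ℕ) :
    ∏ k ∈ Finset.range n, (q ^ 2) ^ k = q ^ ((n : ℤ) ^ 2 - n) := by
  induction n with
  | zero => simp
  | succ n ih =>
    rw [Finset.prod_range_succ, ih, ← pow_mul, ← zpow_natCast, ← zpow_add₀ hq0]
    congr 1
    push_cast
    ring

lemma prod_range_add_pow (q : ℂ) (m n : ℕ) :
    ∏ k ∈ Finset.range (m + n), q ^ k =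
      (∏ k ∈ Finset.range m, q ^ k) * (∏ k ∈ Finset.range n, q ^ k) * q ^ (m * n) := by
  simp only [Finset.prod_range_add, pow_add, Finset.prod_mul_distrib, Finset.prod_const,
    Finset.card_range, pow_mul]
  ring

/-- The part of the summand that depends only on the index sums
$a=N_1+N_4$, $b=N_2+N_5$, $c=N_3+N_6$. -/
noncomputable def coupling (q z : ℂ) (a b c : ℕ) : ℂ :=
  z ^ (a + c) * q ^ (a * b + a * c + b * c) * ∏ k ∈ Finset.range c, (q ^ 2) ^ k

/-- The summand indexed by $((N_1,N_4),(N_2,N_5),(N_6,N_3))$, in factored form. -/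
noncomputable def pairedTerm (q z : ℂ) (p : (ℕ × ℕ) × (ℕ × ℕ) × (ℕ × ℕ)) : ℂ :=
  qDiffCoeff (q ^ 2) 0 1 p.1.1 * (q ^ p.1.2 * qDiffCoeff (q ^ 2) 0 1 p.1.2) *
    (qDiffCoeff (q ^ 2) 0 1 p.2.1.1 * (q ^ p.2.1.2 * qDiffCoeff (q ^ 2) 0 1 p.2.1.2) *
      (qDiffCoeff (q ^ 2) (-1) 0 p.2.2.1 * (q ^ p.2.2.2 * qDiffCoeff (q ^ 2) (-1) 0 p.2.2.2) *
        coupling q z (p.1.1 + p.1.2) (p.2.1.1 + p.2.1.2) (p.2.2.1 + p.2.2.2)))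

lemma summable_pairedTerm {q : ℂ} (hq : ‖q‖ < 1) (z : ℂ) : Summable (pairedTerm q z) := by
  set w : ℝ := max 1 ‖z‖
  have hw : 1 ≤ w := le_max_left _ _
  set S : ℕ → ℝ := fun n => ‖(w : ℂ) ^ n * qDiffCoeff (q ^ 2) 0 1 n‖ with hS
  have hS0 : 0 ≤ S := fun n => norm_nonneg _
  have hS1 : Summable S := (summable_pow_mul_qDiffCoeff (norm_sq_lt_one hq) (w : ℂ)).norm
  have hS2 : Summable fun x : ℕ × ℕ => S x.1 * S x.2 := hS1.mul_of_nonneg hS1 hS0 hS0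
  have hS20 : 0 ≤ fun x : ℕ × ℕ => S x.1 * S x.2 := fun x => mul_nonneg (hS0 _) (hS0 _)
  have hS6 := hS2.mul_of_nonneg (hS2.mul_of_nonneg hS2 hS20 hS20) hS20
    (fun x => mul_nonneg (hS20 _) (hS20 _))
  refine hS6.of_norm_bounded ?_
  rintro ⟨⟨n₁, n₄⟩, ⟨n₂, n₅⟩, ⟨n₆, n₃⟩⟩
  have hfac : pairedTerm q z ((n₁, n₄), (n₂, n₅), (n₆, n₃)) =
      qDiffCoeff (q ^ 2) 0 1 n₁ * qDiffCoeff (q ^ 2) 0 1 n₄ *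
        (qDiffCoeff (q ^ 2) 0 1 n₂ * qDiffCoeff (q ^ 2) 0 1 n₅ *
          (qDiffCoeff (q ^ 2) 0 1 n₆ * qDiffCoeff (q ^ 2) 0 1 n₃)) *
        (z ^ (n₁ + n₄ + (n₆ + n₃)) * q ^ (n₄ + n₅ + n₃ + (n₁ + n₄) * (n₂ + n₅) +
          (n₁ + n₄) * (n₆ + n₃) + (n₂ + n₅) * (n₆ + n₃) + 2 * (n₆ * n₃))) := by
    simp only [pairedTerm, coupling, qDiffCoeff_neg_one_zero, prod_range_add_pow,
      qDiffCoeff_zero_one]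
    ring
  have hq1 : ∀ n : ℕ, ‖q‖ ^ n ≤ 1 := fun n => pow_le_one₀ (norm_nonneg _) hq.le
  have hz : ∀ m : ℕ, ‖z‖ ^ (n₁ + n₄ + (n₆ + n₃)) * ‖q‖ ^ m ≤
      w ^ (n₁ + n₄ + (n₂ + n₅ + (n₆ + n₃))) := fun m =>
    calc ‖z‖ ^ (n₁ + n₄ + (n₆ + n₃)) * ‖q‖ ^ m ≤ ‖z‖ ^ (n₁ + n₄ + (n₆ + n₃)) :=
          mul_le_of_le_one_right (by positivity) (hq1 m)
      _ ≤ w ^ (n₁ + n₄ + (n₆ + n₃)) := by gcongr; exact le_max_right _ _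
      _ ≤ w ^ (n₁ + n₄ + (n₂ + n₅ + (n₆ + n₃))) := pow_le_pow_right₀ hw (by omega)
  rw [hfac]
  simp only [hS, norm_mul, norm_pow, Complex.norm_real, Real.norm_eq_abs,
    abs_of_nonneg (zero_le_one.trans hw)]
  refine (mul_le_mul_of_nonneg_left (hz _) (by positivity)).trans_eq ?_
  ring

/-- The reindexing that pairs $N_1$ with $N_4$, $N_2$ with $N_5$ and $N_6$ with $N_3$. -/
def pairingEquiv : (ℕ × ℕ) × (ℕ × ℕ) × (ℕ × ℕ) ≃ ℕ × ℕ × ℕ × ℕ × ℕ × ℕ where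
  toFun p := (p.1.1, p.2.1.1, p.2.2.2, p.1.2, p.2.1.2, p.2.2.1)
  invFun n := ((n.1, n.2.2.2.1), (n.2.1, n.2.2.2.2.1), (n.2.2.2.2.2, n.2.2.1))
  left_inv _ := rfl
  right_inv _ := rfl

lemma term_eq_pairedTerm {q : ℂ} (hq0 : q ≠ 0) (z : ℂ) (n₁ n₂ n₃ n₄ n₅ n₆ : ℕ) :
    z ^ (n₁ + n₃ + n₄ + n₆) *
        q ^ ((Q4 n₁ n₂ n₃ n₄ n₅ n₆ : ℤ) - ((n₁ : ℤ) + n₂ + n₆)) /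
        (qPoch (q ^ 2) (q ^ 2) n₁ * qPoch (q ^ 2) (q ^ 2) n₂ *
          qPoch (q ^ 2) (q ^ 2) n₃ * qPoch (q ^ 2) (q ^ 2) n₄ *
          qPoch (q ^ 2) (q ^ 2) n₅ * qPoch (q ^ 2) (q ^ 2) n₆) =
      pairedTerm q z ((n₁, n₄), (n₂, n₅), (n₆, n₃)) := by
  have hpow : q ^ ((Q4 n₁ n₂ n₃ n₄ n₅ n₆ : ℤ) - ((n₁ : ℤ) + n₂ + n₆)) =
      q ^ ((n₁ : ℤ) ^ 2 - n₁) * q ^ n₄ * q ^ ((n₄ : ℤ) ^ 2 - n₄) * q ^ ((n₂ : ℤ) ^ 2 - n₂) *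
        q ^ n₅ * q ^ ((n₅ : ℤ) ^ 2 - n₅) * q ^ n₃ *
        q ^ ((n₁ + n₄) * (n₂ + n₅) + (n₁ + n₄) * (n₆ + n₃) + (n₂ + n₅) * (n₆ + n₃)) *
        q ^ (((n₆ + n₃ : ℕ) : ℤ) ^ 2 - (n₆ + n₃ : ℕ)) := by
    simp only [← zpow_natCast, ← zpow_add₀ hq0]
    congr 1
    simp only [Q4]
    push_cast
    ring
  simp only [pairedTerm, coupling, qDiffCoeff_neg_one_zero, qDiffCoeff_zero_one,
    prod_range_sq_pow hq0]
  rw [hpow]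
  ring

/-- Summation over the three pairs, each along its antidiagonals. -/
lemma hasSum_triple {q z s : ℂ} (hq : ‖q‖ < 1) (h : HasSum (pairedTerm q z) s) :
    HasSum (fun p : ℕ × ℕ × ℕ => qDiffCoeff q (-1) 0 p.1 * (qDiffCoeff q 0 1 p.2.1 *
      (qDiffCoeff q 0 1 p.2.2 * coupling q z p.2.1 p.2.2 p.1))) s := by
  have h1 := HasSum.mul_antidiagonal (sum_antidiagonal_qDiffCoeff_sq hq 0 1)
    (R := fun k (p : (ℕ × ℕ) × (ℕ × ℕ)) => qDiffCoeff (q ^ 2) 0 1 p.1.1 *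
      (q ^ p.1.2 * qDiffCoeff (q ^ 2) 0 1 p.1.2) *
      (qDiffCoeff (q ^ 2) (-1) 0 p.2.1 * (q ^ p.2.2 * qDiffCoeff (q ^ 2) (-1) 0 p.2.2) *
        coupling q z k (p.1.1 + p.1.2) (p.2.1 + p.2.2))) h
  have h2 := HasSum.mul_antidiagonal (sum_antidiagonal_qDiffCoeff_sq hq 0 1)
    (R := fun k (p : (ℕ × ℕ) × ℕ) => qDiffCoeff q 0 1 p.2 *
      (qDiffCoeff (q ^ 2) (-1) 0 p.1.1 * (q ^ p.1.2 * qDiffCoeff (q ^ 2) (-1) 0 p.1.2) *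
        coupling q z p.2 k (p.1.1 + p.1.2)))
    (h1.rotate.congr_fun fun p => mul_left_comm _ _ _)
  exact HasSum.mul_antidiagonal (sum_antidiagonal_qDiffCoeff_sq hq (-1) 0)
    (R := fun k (p : ℕ × ℕ) => qDiffCoeff q 0 1 p.1 *
      (qDiffCoeff q 0 1 p.2 * coupling q z p.1 p.2 k))
    (h2.rotate.congr_fun fun p => by ring)

lemma hasSum_double {q z s : ℂ} (hq : ‖q‖ < 1) (h : HasSum (pairedTerm q z) s) :
    HasSum (fun p : ℕ × ℕ => qDiffCoeff q (-1) 1 p.1 * (z ^ p.1 *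
      (∏ k ∈ Finset.range p.1, q ^ k) * ((q ^ p.1) ^ p.2 * qDiffCoeff q 0 1 p.2))) s := by
  refine HasSum.mul_antidiagonal (sum_antidiagonal_qDiffCoeff_mul hq (-1) 1)
    (R := fun m b => z ^ m * (∏ k ∈ Finset.range m, q ^ k) *
      ((q ^ m) ^ b * qDiffCoeff q 0 1 b)) ?_
  have h3 := (Equiv.prodAssoc ℕ ℕ ℕ).hasSum_iff.2
    (((Equiv.refl ℕ).prodCongr (Equiv.prodComm ℕ ℕ)).hasSum_iff.2 (hasSum_triple hq h).rotate)
  refine h3.congr_fun ?_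
  rintro ⟨⟨a, c⟩, b⟩
  simp [coupling, qDiffCoeff_neg_one_zero, qDiffCoeff_zero_one, prod_range_add_pow,
    pow_right_comm _ 2, Finset.prod_pow]
  ring

lemma tsum_pairedTerm {q : ℂ} (hq : ‖q‖ < 1) (z : ℂ) :
    ∑' p, pairedTerm q z p = qPochInf q (-z) * qPochInf q (-1) := by
  have hs := (summable_pairedTerm hq z).hasSum
  have hM : HasSum (fun m : ℕ => qDiffCoeff q (-1) 1 m * (z ^ m *
      (∏ k ∈ Finset.range m, q ^ k) * qPochInf q (-q ^ m))) (∑' p, pairedTerm q z p) :=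
    HasSum.prod_fiberwise (hasSum_double hq hs) fun m => by
      exact ((hasSum_pow_mul_qDiffCoeff hq (q ^ m)).mul_left
        (z ^ m * ∏ k ∈ Finset.range m, q ^ k)).mul_left (qDiffCoeff q (-1) 1 m)
  have hM' : HasSum (fun m : ℕ => z ^ m * qDiffCoeff q 0 1 m * qPochInf q (-1))
      (∑' p, pairedTerm q z p) := by
    refine hM.congr_fun fun m => ?_
    rw [← qPoch_mul_qPochInf hq (-1) m, qDiffCoeff_neg_one_one, qDiffCoeff_zero_one,
      neg_one_mul]
    ring
  exact hM'.unique ((hasSum_pow_mul_qDiffCoeff hq z).mul_right _)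

/-- For nonzero $z$:
$\sum_{N_1,\dots,N_6\ge0} z^{N_1+N_3+N_4+N_6}
 q^{N^TG_4N-(N_1+N_2+N_6)}/\prod_i(q^2;q^2)_{N_i} = 2(-z;q)_\infty/(q;q^2)_\infty$. -/
theorem G4_z_specialisation (q z : ℂ) (hq : ‖q‖ < 1) (hq0 : q ≠ 0) (hz : z ≠ 0) :
    (∑' n : ℕ × ℕ × ℕ × ℕ × ℕ × ℕ,
        match n with
        | (n₁, n₂, n₃, n₄, n₅, n₆) =>
          z ^ (n₁ + n₃ + n₄ + n₆) *
            q ^ ((Q4 n₁ n₂ n₃ n₄ n₅ n₆ : ℤ) - ((n₁ : ℤ) + n₂ + n₆)) /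
            (qPoch (q ^ 2) (q ^ 2) n₁ * qPoch (q ^ 2) (q ^ 2) n₂ *
              qPoch (q ^ 2) (q ^ 2) n₃ * qPoch (q ^ 2) (q ^ 2) n₄ *
              qPoch (q ^ 2) (q ^ 2) n₅ * qPoch (q ^ 2) (q ^ 2) n₆))
      = 2 * qPochInf q (-z) / qPochInf (q ^ 2) q := by
  have hval : 2 * qPochInf q (-z) / qPochInf (q ^ 2) q = ∑' p, pairedTerm q z p := by
    rw [tsum_pairedTerm hq z, qPochInf_neg_one hq]
    ring
  rw [hval, ← pairingEquiv.symm.tsum_eq (pairedTerm q z)]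
  refine tsum_congr ?_
  rintro ⟨n₁, n₂, n₃, n₄, n₅, n₆⟩
  exact term_eq_pairedTerm hq0 z n₁ n₂ n₃ n₄ n₅ n₆
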